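/- Lemma 4.4. For the kernel Ḡ defined in the context: for each fixed x ∈ ℝ, the function y ↦ Ḡ(y, x − y) is nondecreasing on ℝ, and the function y ↦ Ḡ(y, x) is nonincreasing on ℝ. -/

import Mathlib

/-- `Ḡ(y, x - y)` for `y ≥ 0` in the cover-time problem, written as a function of `y`
and `s = x - y`: it equals `1` if `x = s + y ≤ 0` and
`e^{-(x² + y²)} ∑ₖ (x^{2k}/k!) ∑_{j ≥ k} y^{2j}/j!` if `x > 0`. -/
noncomputable def Gker0 (y s : ℝ) : ℝ :=
  if s + y ≤ 0 then 1 else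
    Real.exp (-((s + y) ^ 2 + y ^ 2)) *
      ∑' k : ℕ, ((s + y) ^ (2 * k) / (Nat.factorial k : ℝ)) *
        ∑' j : ℕ, (if k ≤ j then y ^ (2 * j) / (Nat.factorial j : ℝ) else 0)

/-- The cover-time kernel `Ḡ(y, s)` of Aldous's recursion, with `Ḡ(y, s) = Ḡ(0, s)` for
`y < 0`. -/
noncomputable def Gker (y s : ℝ) : ℝ := if 0 ≤ y then Gker0 y s else Gker0 0 s

open Finset Filter Topology

/-- The Poisson weight `e^{-b} bᵏ / k!`. -/
noncomputable def poissonWeight (k : ℕ) (b : ℝ) : ℝ :=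
  Real.exp (-b) * (b ^ k / (k.factorial : ℝ))

/-- The Poisson tail `P(N ≥ k)` for `N` Poisson with mean `b`. -/
noncomputable def poissonTail (k : ℕ) (b : ℝ) : ℝ :=
  1 - ∑ j ∈ range k, poissonWeight j b

lemma poissonWeight_nonneg (k : ℕ) {b : ℝ} (hb : 0 ≤ b) : 0 ≤ poissonWeight k b := by
  unfold poissonWeight; positivity

lemma poissonWeight_succ (k : ℕ) (b : ℝ) :
    poissonWeight (k + 1) b = b / (k + 1) * poissonWeight k b := by
  unfold poissonWeight
  rw [Nat.factorial_succ]
  push_cast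
  field_simp
  ring

lemma hasSum_pow_div_factorial (b : ℝ) :
    HasSum (fun k : ℕ => b ^ k / (k.factorial : ℝ)) (Real.exp b) := by
  rw [Real.exp_eq_exp_ℝ]
  exact NormedSpace.expSeries_div_hasSum_exp b

lemma hasSum_poissonWeight (b : ℝ) : HasSum (fun k => poissonWeight k b) 1 := by
  have h := (hasSum_pow_div_factorial b).mul_left (Real.exp (-b))
  rwa [← Real.exp_add, neg_add_cancel, Real.exp_zero] at h

lemma poissonTail_zero (b : ℝ) : poissonTail 0 b = 1 := by simp [poissonTail]

lemma poissonTail_succ (k : ℕ) (b : ℝ) :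
    poissonTail (k + 1) b = poissonTail k b - poissonWeight k b := by
  simp only [poissonTail, sum_range_succ]; ring

lemma poissonTail_nonneg (k : ℕ) {b : ℝ} (hb : 0 ≤ b) : 0 ≤ poissonTail k b :=
  sub_nonneg.2 <| sum_le_hasSum _ (fun j _ => poissonWeight_nonneg j hb) (hasSum_poissonWeight b)

lemma poissonTail_le_one (k : ℕ) {b : ℝ} (hb : 0 ≤ b) : poissonTail k b ≤ 1 :=
  sub_le_self _ <| sum_nonneg fun j _ => poissonWeight_nonneg j hb

lemma poissonTail_succ_at_zero (k : ℕ) : poissonTail (k + 1) 0 = 0 := by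
  simp [poissonTail, sum_range_succ', poissonWeight]

lemma hasDerivAt_poissonWeight_zero (b : ℝ) :
    HasDerivAt (poissonWeight 0) (-poissonWeight 0 b) b := by
  have hf : poissonWeight 0 = fun t => Real.exp (-t) := by
    funext t
    simp [poissonWeight]
  rw [hf]
  simpa using (hasDerivAt_neg b).exp

lemma hasDerivAt_poissonWeight_succ (k : ℕ) (b : ℝ) :
    HasDerivAt (poissonWeight (k + 1)) (poissonWeight k b - poissonWeight (k + 1) b) b := by
  have h := (hasDerivAt_neg b).exp.mul
    ((hasDerivAt_pow (k + 1) b).div_const ((k + 1).factorial : ℝ))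
  refine h.congr_deriv ?_
  simp only [poissonWeight, Nat.factorial_succ, add_tsub_cancel_right]
  push_cast
  field_simp
  ring

lemma hasDerivAt_poissonTail_succ (k : ℕ) (b : ℝ) :
    HasDerivAt (poissonTail (k + 1)) (poissonWeight k b) b := by
  induction k with
  | zero =>
    have h := (hasDerivAt_poissonWeight_zero b).const_sub 1
    rw [neg_neg] at h
    exact h.congr_of_eventuallyEq (.of_forall fun t => by
      rw [poissonTail_succ, poissonTail_zero])
  | succ k ih =>
    have h := ih.sub (hasDerivAt_poissonWeight_succ k b)
    rw [sub_sub_cancel] at h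
    exact h.congr_of_eventuallyEq (.of_forall fun t => by
      rw [poissonTail_succ]; rfl)

lemma monotoneOn_poissonTail (k : ℕ) : MonotoneOn (poissonTail k) (Set.Ici 0) := by
  cases k with
  | zero =>
    intro a _ b _ _
    rw [poissonTail_zero, poissonTail_zero]
  | succ k =>
    refine monotoneOn_of_deriv_nonneg (convex_Ici 0)
      (fun b _ => (hasDerivAt_poissonTail_succ k b).continuousAt.continuousWithinAt)
      (fun b _ => (hasDerivAt_poissonTail_succ k b).differentiableAt.differentiableWithinAt) ?_
    intro b hb
    rw [interior_Ici] at hb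
    rw [(hasDerivAt_poissonTail_succ k b).deriv]
    exact poissonWeight_nonneg k (le_of_lt hb)

lemma summable_poissonWeight_mul_poissonTail {a b : ℝ} (ha : 0 ≤ a) (hb : 0 ≤ b) :
    Summable fun k => poissonWeight k a * poissonTail k b :=
  (hasSum_poissonWeight a).summable.of_nonneg_of_le
    (fun k => mul_nonneg (poissonWeight_nonneg k ha) (poissonTail_nonneg k hb))
    (fun k => mul_le_of_le_one_right (poissonWeight_nonneg k ha) (poissonTail_le_one k hb))

lemma tsum_ite_le_pow_div_factorial (k : ℕ) (b : ℝ) :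
    ∑' j : ℕ, (if k ≤ j then b ^ j / (j.factorial : ℝ) else 0) =
      Real.exp b * poissonTail k b := by
  have h := (hasSum_pow_div_factorial b).sub
    (hasSum_sum_of_ne_finset_zero (s := range k)
      (f := fun j : ℕ => if j < k then b ^ j / (j.factorial : ℝ) else 0)
      (fun j hj => if_neg (by simpa using hj)))
  have hf : (fun j : ℕ => if k ≤ j then b ^ j / (j.factorial : ℝ) else 0) =
      fun j : ℕ => b ^ j / (j.factorial : ℝ) -
        if j < k then b ^ j / (j.factorial : ℝ) else 0 := by
    funext j
    by_cases hj : k ≤ j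
    · simp [hj, not_lt.2 hj]
    · simp [hj, not_le.1 hj]
  rw [hf, h.tsum_eq, poissonTail, mul_sub, mul_one, mul_sum]
  congr 1
  refine sum_congr rfl fun j hj => ?_
  rw [if_pos (mem_range.1 hj), poissonWeight, ← mul_assoc, ← Real.exp_add, add_neg_cancel,
    Real.exp_zero, one_mul]

lemma Gker0_of_nonpos {y s : ℝ} (h : s + y ≤ 0) : Gker0 y s = 1 := if_pos h

lemma Gker0_of_pos {y s : ℝ} (h : 0 < s + y) :
    Gker0 y s = ∑' k, poissonWeight k ((s + y) ^ 2) * poissonTail k (y ^ 2) := by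
  rw [Gker0, if_neg h.not_ge, ← tsum_mul_left]
  refine tsum_congr fun k => ?_
  simp only [pow_mul]
  rw [tsum_ite_le_pow_div_factorial, poissonWeight, neg_add, Real.exp_add, Real.exp_neg (y ^ 2)]
  field_simp

lemma Gker0_le_one (y s : ℝ) : Gker0 y s ≤ 1 := by
  rcases le_or_gt (s + y) 0 with h | h
  · rw [Gker0_of_nonpos h]
  · rw [Gker0_of_pos h, ← (hasSum_poissonWeight ((s + y) ^ 2)).tsum_eq]
    exact (summable_poissonWeight_mul_poissonTail (sq_nonneg _) (sq_nonneg _)).tsum_le_tsum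
      (fun k => mul_le_of_le_one_right (poissonWeight_nonneg k (sq_nonneg _))
        (poissonTail_le_one k (sq_nonneg _)))
      (hasSum_poissonWeight _).summable

lemma Gker0_zero_of_pos {s : ℝ} (h : 0 < s) : Gker0 0 s = Real.exp (-s ^ 2) := by
  rw [Gker0_of_pos (by simpa using h), tsum_eq_single 0]
  · simp [poissonWeight, poissonTail]
  · intro k hk
    obtain ⟨k, rfl⟩ := Nat.exists_eq_succ_of_ne_zero hk
    simp [poissonTail_succ_at_zero]

lemma antitone_Gker0_zero : Antitone (Gker0 0) := by
  intro s t hst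
  rcases le_or_gt s 0 with hs | hs
  · rw [Gker0_of_nonpos (y := 0) (s := s) (by simpa using hs)]
    exact Gker0_le_one 0 t
  · rw [Gker0_zero_of_pos hs, Gker0_zero_of_pos (hs.trans_le hst)]
    gcongr

lemma monotoneOn_Gker0_sub (x : ℝ) : MonotoneOn (fun y => Gker0 y (x - y)) (Set.Ici 0) := by
  intro y hy z hz hyz
  rcases le_or_gt x 0 with hx | hx
  · simp only
    rw [Gker0_of_nonpos (by simpa using hx), Gker0_of_nonpos (by simpa using hx)]
  · simp only
    rw [Gker0_of_pos (by simpa using hx), Gker0_of_pos (by simpa using hx)]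
    simp only [sub_add_cancel]
    refine (summable_poissonWeight_mul_poissonTail (sq_nonneg _) (sq_nonneg _)).tsum_le_tsum
      (fun k => ?_) (summable_poissonWeight_mul_poissonTail (sq_nonneg _) (sq_nonneg _))
    exact mul_le_mul_of_nonneg_left
      (monotoneOn_poissonTail k (sq_nonneg y) (sq_nonneg z) (pow_le_pow_left₀ hy hyz 2))
      (poissonWeight_nonneg k (sq_nonneg x))

/-- The derivative of the partial sums in `y` telescopes by summation by parts. -/
lemma hasDerivAt_sum_poissonWeight_mul_poissonTail (n : ℕ) (s y : ℝ) :
    HasDerivAt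
      (fun y => ∑ k ∈ range (n + 1), poissonWeight k ((s + y) ^ 2) * poissonTail k (y ^ 2))
      (2 * y * ∑ k ∈ range n, poissonWeight (k + 1) ((s + y) ^ 2) * poissonWeight k (y ^ 2) -
        2 * (s + y) *
          (∑ k ∈ range n, poissonWeight k ((s + y) ^ 2) * poissonWeight k (y ^ 2) +
            poissonWeight n ((s + y) ^ 2) * poissonTail n (y ^ 2))) y := by
  have hx : HasDerivAt (fun y : ℝ => (s + y) ^ 2) (2 * (s + y)) y := by
    simpa using ((hasDerivAt_id y).const_add s).fun_pow 2
  have hy : HasDerivAt (fun y : ℝ => y ^ 2) (2 * y) y := by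
    simpa using hasDerivAt_pow 2 y
  induction n with
  | zero =>
    have h := (hasDerivAt_poissonWeight_zero ((s + y) ^ 2)).comp y hx
    simp only [zero_add, sum_range_one, range_zero, sum_empty, poissonTail_zero, mul_one]
    exact h.congr_deriv (by ring)
  | succ n ih =>
    have h := ih.add (((hasDerivAt_poissonWeight_succ n ((s + y) ^ 2)).comp y hx).mul
      ((hasDerivAt_poissonTail_succ n (y ^ 2)).comp y hy))
    have hf : (fun y => ∑ k ∈ range (n + 1 + 1),
        poissonWeight k ((s + y) ^ 2) * poissonTail k (y ^ 2)) =
        fun y => ∑ k ∈ range (n + 1), poissonWeight k ((s + y) ^ 2) * poissonTail k (y ^ 2) +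
          poissonWeight (n + 1) ((s + y) ^ 2) * poissonTail (n + 1) (y ^ 2) :=
      funext fun y => sum_range_succ _ _
    rw [hf]
    refine h.congr_deriv ?_
    simp only [sum_range_succ _ n, Function.comp_apply, poissonTail_succ]
    ring

lemma two_mul_poissonWeight_succ_mul_le {x : ℝ} (hx : 0 ≤ x) (y : ℝ) (k : ℕ) :
    2 * y * (poissonWeight (k + 1) (x ^ 2) * poissonWeight k (y ^ 2)) ≤
      x * (poissonWeight k (x ^ 2) * poissonWeight k (y ^ 2)) +
        x * (poissonWeight (k + 1) (x ^ 2) * poissonWeight (k + 1) (y ^ 2)) := by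
  have hw := mul_nonneg (poissonWeight_nonneg k (sq_nonneg x))
    (poissonWeight_nonneg k (sq_nonneg y))
  have h := mul_nonneg (mul_nonneg hx hw) (sq_nonneg (1 - x * y / (k + 1)))
  rw [poissonWeight_succ, poissonWeight_succ]
  refine sub_nonneg.1 (h.trans_eq ?_)
  field_simp
  ring

lemma two_mul_sum_poissonWeight_succ_mul_le {x : ℝ} (hx : 0 ≤ x) (y : ℝ) (n : ℕ) :
    2 * y * ∑ k ∈ range n, poissonWeight (k + 1) (x ^ 2) * poissonWeight k (y ^ 2) ≤
      2 * x * ∑ k ∈ range n, poissonWeight k (x ^ 2) * poissonWeight k (y ^ 2) +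
        x * (poissonWeight n (x ^ 2) * poissonWeight n (y ^ 2)) := by
  induction n with
  | zero =>
    simpa using mul_nonneg hx (mul_nonneg (poissonWeight_nonneg 0 (sq_nonneg x))
      (poissonWeight_nonneg 0 (sq_nonneg y)))
  | succ n ih =>
    rw [sum_range_succ, sum_range_succ]
    linarith [two_mul_poissonWeight_succ_mul_le hx y n]

lemma antitoneOn_sum_poissonWeight_mul_poissonTail (n : ℕ) (s : ℝ) :
    AntitoneOn
      (fun y => ∑ k ∈ range (n + 1), poissonWeight k ((s + y) ^ 2) * poissonTail k (y ^ 2))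
      (Set.Ici (-s)) := by
  have hd := hasDerivAt_sum_poissonWeight_mul_poissonTail n s
  refine antitoneOn_of_deriv_nonpos (convex_Ici _)
    (fun y _ => (hd y).continuousAt.continuousWithinAt)
    (fun y _ => (hd y).differentiableAt.differentiableWithinAt) fun y hy => ?_
  rw [interior_Ici, Set.mem_Ioi] at hy
  rw [(hd y).deriv]
  have hx : 0 ≤ s + y := by linarith
  have hp := poissonWeight_nonneg n (sq_nonneg (s + y))
  have hq : poissonWeight n (y ^ 2) ≤ poissonTail n (y ^ 2) := by
    have := poissonTail_nonneg (n + 1) (sq_nonneg y)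
    rw [poissonTail_succ] at this
    linarith
  have h₁ := mul_le_mul_of_nonneg_left (mul_le_mul_of_nonneg_left hq hp) hx
  have h₂ := mul_nonneg hx (mul_nonneg hp (poissonTail_nonneg n (sq_nonneg y)))
  linarith [two_mul_sum_poissonWeight_succ_mul_le hx y n]

lemma antitone_Gker0_left (s : ℝ) : Antitone fun y => Gker0 y s := by
  intro y z hyz
  simp only
  rcases le_or_gt (s + y) 0 with h | h
  · rw [Gker0_of_nonpos h]
    exact Gker0_le_one z s
  · have hz : 0 < s + z := by linarith
    rw [Gker0_of_pos h, Gker0_of_pos hz]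
    have ht (t : ℝ) := (tendsto_add_atTop_iff_nat 1).2
      (summable_poissonWeight_mul_poissonTail (sq_nonneg (s + t))
        (sq_nonneg t)).hasSum.tendsto_sum_nat
    exact le_of_tendsto_of_tendsto' (ht z) (ht y) fun n =>
      antitoneOn_sum_poissonWeight_mul_poissonTail n s
        (Set.mem_Ici.2 (by linarith)) (Set.mem_Ici.2 (by linarith)) hyz

/-- Lemma 4.4: for the cover-time kernel, `y ↦ Ḡ(y, x-y)` is nondecreasing and
`y ↦ Ḡ(y, x)` is nonincreasing. -/
theorem cover_kernel_monotonicity :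
    (∀ x : ℝ, Monotone fun y => Gker y (x - y)) ∧
    (∀ x : ℝ, Antitone fun y => Gker y x) := by
  have hG (y s : ℝ) : Gker y s = Gker0 (max y 0) s := by
    rcases le_or_gt 0 y with h | h
    · rw [Gker, if_pos h, max_eq_left h]
    · rw [Gker, if_neg h.not_ge, max_eq_right h.le]
  refine ⟨fun x y z hyz => ?_, fun x y z hyz => ?_⟩
  · simp only [hG]
    rcases le_or_gt 0 y with hy | hy
    · rw [max_eq_left hy, max_eq_left (hy.trans hyz)]
      exact monotoneOn_Gker0_sub x hy (hy.trans hyz) hyz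
    · rw [max_eq_right hy.le]
      rcases le_or_gt 0 z with hz | hz
      · rw [max_eq_left hz]
        have h₀ := monotoneOn_Gker0_sub x (Set.mem_Ici.2 le_rfl) hz hz
        simp only [sub_zero] at h₀
        exact (antitone_Gker0_zero (by linarith)).trans h₀
      · rw [max_eq_right hz.le]
        exact antitone_Gker0_zero (by linarith)
  · simp only [hG]
    exact antitone_Gker0_left x (max_le_max_right 0 hyz)
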